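/- The minimax and maximin values of the counterexample matrix game coincide and equal -9/13: sup over p ∈ [0,1] of (inf over q ∈ [0,1] of u(p,q)) equals -9/13, and inf over q ∈ [0,1] of (sup over p ∈ [0,1] of u(p,q)) equals -9/13. -/

import Mathlib

/-- Player 1's expected payoff in the counterexample matrix game
    A = [[-1, 1], [1, -10]]. -/
noncomputable def u (p q : ℝ) : ℝ :=
  -p*q + p*(1-q) + (1-p)*q - 10*(1-p)*(1-q)

/-- The maximin and minimax values of the counterexample matrix game
    coincide and equal -9/13. -/
theorem stmt_9 :
    (⨆ p : Set.Icc (0:ℝ) 1, ⨅ q : Set.Icc (0:ℝ) 1, u p.1 q.1) = -9/13 ∧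
    (⨅ q : Set.Icc (0:ℝ) 1, ⨆ p : Set.Icc (0:ℝ) 1, u p.1 q.1) = -9/13 := by
  have hu : ∀ p q : ℝ, u p q = -9/13 - 13 * (p - 11/13) * (q - 11/13) := by
    intro p q; unfold u; ring
  have hlo : ∀ p q : Set.Icc (0:ℝ) 1, -100 ≤ u p.1 q.1 := by
    rintro ⟨p, hp0, hp1⟩ ⟨q, hq0, hq1⟩
    simp only [u]
    nlinarith [mul_nonneg hp0 hq0, mul_le_one₀ hp1 hq0 hq1]
  have hhi : ∀ p q : Set.Icc (0:ℝ) 1, u p.1 q.1 ≤ 100 := by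
    rintro ⟨p, hp0, hp1⟩ ⟨q, hq0, hq1⟩
    simp only [u]
    nlinarith [mul_nonneg hp0 hq0, mul_le_one₀ hp1 hq0 hq1]
  let c : Set.Icc (0:ℝ) 1 := ⟨11/13, by norm_num, by norm_num⟩
  have hcq : ∀ q : Set.Icc (0:ℝ) 1, u c.1 q.1 = -9/13 := by
    intro q; rw [hu]; simp [c]
  have hpc : ∀ p : Set.Icc (0:ℝ) 1, u p.1 c.1 = -9/13 := by
    intro p; rw [hu]; simp [c]
  have hbb : ∀ p : Set.Icc (0:ℝ) 1, BddBelow (Set.range fun q : Set.Icc (0:ℝ) 1 => u p.1 q.1) := by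
    intro p; refine ⟨-100, ?_⟩; rintro _ ⟨q, rfl⟩; exact hlo p q
  have hba : ∀ q : Set.Icc (0:ℝ) 1, BddAbove (Set.range fun p : Set.Icc (0:ℝ) 1 => u p.1 q.1) := by
    intro q; refine ⟨100, ?_⟩; rintro _ ⟨p, rfl⟩; exact hhi p q
  have h1 : ∀ p : Set.Icc (0:ℝ) 1, (⨅ q : Set.Icc (0:ℝ) 1, u p.1 q.1) ≤ -9/13 := fun p =>
    (ciInf_le (hbb p) c).trans (hpc p).le
  have h2 : ∀ q : Set.Icc (0:ℝ) 1, -9/13 ≤ (⨆ p : Set.Icc (0:ℝ) 1, u p.1 q.1) := fun q =>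
    (hcq q).ge.trans (le_ciSup (hba q) c)
  constructor
  · apply le_antisymm (ciSup_le h1)
    refine le_trans (le_ciInf fun q => (hcq q).ge) (le_ciSup (f := fun p : Set.Icc (0:ℝ) 1 =>
      ⨅ q : Set.Icc (0:ℝ) 1, u p.1 q.1) ⟨-9/13, ?_⟩ c)
    rintro _ ⟨p, rfl⟩; exact h1 p
  · refine le_antisymm ?_ (le_ciInf h2)
    refine le_trans (ciInf_le (f := fun q : Set.Icc (0:ℝ) 1 =>
      ⨆ p : Set.Icc (0:ℝ) 1, u p.1 q.1) ⟨-9/13, ?_⟩ c) (ciSup_le fun p => (hpc p).le)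
    rintro _ ⟨q, rfl⟩; exact h2 q
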